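/- The set {D_σ^η T(z) : z ∈ N_η, σ ∈ Shuffle^η_{ε(z)}} is a basis of L_η as a B_η-module; in particular L_η is a free B_η-module. -/

import Mathlib

open scoped BigOperators

set_option maxHeartbeats 1000000
set_option synthInstance.maxHeartbeats 400000
noncomputable section

namespace GTpaper

variable (r : ℕ) (η : Fin r → ℕ)

/-- The index set Σ(η): pairs (k,i) with 1 ≤ k ≤ r, 1 ≤ i ≤ η_k (0-based). -/
abbrev Idx := (k : Fin r) × Fin (η k)

/-- The polynomial ring ℂ[X_η]. -/
abbrev Pol := MvPolynomial (Idx r η) ℂ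

/-- The field of rational functions F = ℂ(X_η). -/
abbrev FF := FractionRing (Pol r η)

/-- The group S_η = S_{η_1} × ⋯ × S_{η_r}. -/
abbrev Sg := ∀ k : Fin r, Equiv.Perm (Fin (η k))

/-- The action of S_η on the index set. -/
def permIdx (σ : Sg r η) : Equiv.Perm (Idx r η) where
  toFun p := ⟨p.1, σ p.1 p.2⟩
  invFun p := ⟨p.1, (σ p.1)⁻¹ p.2⟩
  left_inv p := by simp
  right_inv p := by simp

/-- The action of S_η on ℂ[X_η] by permuting variables. -/
def actP (σ : Sg r η) : Pol r η ≃+* Pol r η :=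
  (MvPolynomial.renameEquiv ℂ (permIdx r η σ)).toRingEquiv

/-- The action of S_η on F = ℂ(X_η) by field automorphisms. -/
def actF (σ : Sg r η) : FF r η ≃+* FF r η :=
  IsFractionRing.ringEquivOfRingEquiv (actP r η σ)

/-- The variable x_{k,i} viewed as an element of F. -/
def XF (p : Idx r η) : FF r η := algebraMap (Pol r η) (FF r η) (MvPolynomial.X p)

/-- The element of S_η which transposes (k,i) and (k,j) and fixes all other indices. -/
def transpT (k : Fin r) (i j : Fin (η k)) : Sg r η :=
  Function.update (1 : Sg r η) k (Equiv.swap i j)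

/-- The simple transposition s_i^{(k)}. -/
def simpleT (k : Fin r) (i : ℕ) (h : i + 1 < η k) : Sg r η :=
  transpT r η k ⟨i, Nat.lt_of_succ_lt h⟩ ⟨i + 1, h⟩

/-- The divided difference operator ∂_i^{(k)} on F. -/
def dd (k : Fin r) (i : ℕ) (h : i + 1 < η k) (f : FF r η) : FF r η :=
  (f - actF r η (simpleT r η k i h) f) /
    (XF r η ⟨k, ⟨i, Nat.lt_of_succ_lt h⟩⟩ - XF r η ⟨k, ⟨i + 1, h⟩⟩)

/-- Data indexing a simple transposition of S_η. -/
abbrev SimpleDat := (k : Fin r) × {i : ℕ // i + 1 < η k}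

/-- A word in the simple transpositions of S_η. -/
abbrev Word := List (SimpleDat r η)

/-- The element of S_η represented by a word. -/
def wordPerm (w : Word r η) : Sg r η :=
  (w.map fun s => simpleT r η s.1 s.2.1 s.2.2).prod

/-- The composite ∂_{j_1} ∘ ⋯ ∘ ∂_{j_l} of divided differences along a word. -/
def ddWord (w : Word r η) (f : FF r η) : FF r η :=
  w.foldr (fun s g => dd r η s.1 s.2.1 s.2.2 g) f

/-- The length ℓ(σ): the total number of inversions of σ. -/
def len (σ : Sg r η) : ℕ :=
  ∑ k : Fin r,
    (Finset.univ.filter fun p : Fin (η k) × Fin (η k) => p.1 < p.2 ∧ σ k p.2 < σ k p.1).card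

/-- `w` is a reduced decomposition of σ. -/
def IsRed (σ : Sg r η) (w : Word r η) : Prop :=
  wordPerm r η w = σ ∧ w.length = len r η σ

/-- The longest word w_η of S_η. -/
def wEta : Sg r η := fun _ => Fin.revPerm

/-- η! = η_1! ⋯ η_r!. -/
def etaFact : ℕ := ∏ k : Fin r, Nat.factorial (η k)

/-- The Vandermonde-type product Δ_η as a polynomial. -/
def DeltaP : Pol r η :=
  ∏ k : Fin r, ∏ p ∈ Finset.univ.filter (fun p : Fin (η k) × Fin (η k) => p.1 < p.2),
    (MvPolynomial.X (⟨k, p.1⟩ : Idx r η) - MvPolynomial.X (⟨k, p.2⟩ : Idx r η))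

/-- Δ_η as an element of F. -/
def DeltaF : FF r η := algebraMap (Pol r η) (FF r η) (DeltaP r η)

/-- The symmetrization operator sym_η on F. -/
def symF (f : FF r η) : FF r η :=
  (etaFact r η : FF r η)⁻¹ * ∑ σ : Sg r η, actF r η σ f

/-- The sign of an element of S_η. -/
def sgn (σ : Sg r η) : ℤ := ∏ k : Fin r, (Equiv.Perm.sign (σ k) : ℤ)

/-- The antisymmetrization operator asym_η on F. -/
def asymF (f : FF r η) : FF r η :=
  (etaFact r η : FF r η)⁻¹ * ∑ σ : Sg r η, (sgn r η σ : FF r η) * actF r η σ f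

/-- The ideal p_η of ℂ[X_η] generated by the differences x_{k,i} - x_{k,j}. -/
def pIdeal : Ideal (Pol r η) :=
  Ideal.span {q | ∃ (k : Fin r) (i j : Fin (η k)), i < j ∧
    q = MvPolynomial.X (⟨k, i⟩ : Idx r η) - MvPolynomial.X (⟨k, j⟩ : Idx r η)}

/-! ### The Gelfand–Tsetlin setting: μ = (1,2,…,n) -/

/-- The composition μ = (1,2,…,n) (0-based: row k has k+1 entries). -/
abbrev mEta (n : ℕ) : Fin n → ℕ := fun k => (k : ℕ) + 1

/-- The index set of Gelfand–Tsetlin tableaux entries. -/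
abbrev IdxN (n : ℕ) := Idx n (mEta n)

/-- The polynomial ring ℂ[X_μ]. -/
abbrev PolN (n : ℕ) := Pol n (mEta n)

/-- The field K = ℂ(X_μ). -/
abbrev KK (n : ℕ) := FF n (mEta n)

/-- The group S_μ = S_1 × S_2 × ⋯ × S_n. -/
abbrev SgN (n : ℕ) := Sg n (mEta n)

variable (n : ℕ)

/-- The additive group ℤ^μ_0 of integral μ-points with vanishing top row. -/
def Z0sub : AddSubgroup (IdxN n → ℤ) where
  carrier := {z | ∀ p : IdxN n, (p.1 : ℕ) + 1 = n → z p = 0}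
  add_mem' := by intro a b ha hb p hp; simp [ha p hp, hb p hp]
  zero_mem' := by intro p _; rfl
  neg_mem' := by intro a ha p hp; simp [ha p hp]

abbrev Z0 := ↥(Z0sub n)

/-- The K-vector space V_K with basis {T(z) : z ∈ ℤ^μ_0}. -/
def VK : Type := Z0 n →₀ KK n

instance : AddCommGroup (VK n) := inferInstanceAs (AddCommGroup (Z0 n →₀ KK n))
instance : Module (KK n) (VK n) := inferInstanceAs (Module (KK n) (Z0 n →₀ KK n))
instance : Module ℂ (VK n) := inferInstanceAs (Module ℂ (Z0 n →₀ KK n))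
instance : IsScalarTower ℂ (KK n) (VK n) :=
  inferInstanceAs (IsScalarTower ℂ (KK n) (Z0 n →₀ KK n))
instance : SMulCommClass (KK n) (KK n) (VK n) :=
  inferInstanceAs (SMulCommClass (KK n) (KK n) (Z0 n →₀ KK n))

/-- The tableau T(z), as a basis vector of V_K. -/
def T (z : Z0 n) : VK n := Finsupp.single z 1

/-- The translation automorphism f(x) ↦ f(x+z) of ℂ[X_μ]. -/
def shiftP (z : IdxN n → ℤ) : PolN n ≃ₐ[ℂ] PolN n :=
  AlgEquiv.ofAlgHom
    (MvPolynomial.aeval fun p => MvPolynomial.X p + MvPolynomial.C ((z p : ℤ) : ℂ))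
    (MvPolynomial.aeval fun p => MvPolynomial.X p - MvPolynomial.C ((z p : ℤ) : ℂ))
    (by apply MvPolynomial.algHom_ext; intro p; simp)
    (by apply MvPolynomial.algHom_ext; intro p; simp)

/-- The translation automorphism f(x) ↦ f(x+z) of K = ℂ(X_μ). -/
def shiftK (z : IdxN n → ℤ) : KK n ≃+* KK n :=
  IsFractionRing.ringEquivOfRingEquiv (shiftP n z).toRingEquiv

/-- The tuple δ^{k,i} ∈ ℤ^μ_0. -/
def deltaZ (k : ℕ) (hk : k + 1 < n) (i : Fin (k + 1)) : Z0 n :=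
  ⟨Pi.single (⟨⟨k, Nat.lt_of_succ_lt hk⟩, i⟩ : IdxN n) (1 : ℤ), by
    intro p hp
    rw [Pi.single_apply]
    have : p ≠ (⟨⟨k, Nat.lt_of_succ_lt hk⟩, i⟩ : IdxN n) := by
      intro h; rw [h] at hp; simp at hp; omega
    simp [this]⟩

/-- The Gelfand–Tsetlin function e⁺_{k,i} ∈ K (0-based row k, 0 ≤ k ≤ n-2). -/
def ePlus (k : ℕ) (hk : k + 1 < n) (i : Fin (k + 1)) : KK n :=
  (∏ j : Fin (k + 2),
      (XF n (mEta n) ⟨⟨k, Nat.lt_of_succ_lt hk⟩, i⟩ - XF n (mEta n) ⟨⟨k + 1, hk⟩, j⟩)) /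
  (∏ j ∈ Finset.univ.erase i,
      (XF n (mEta n) ⟨⟨k, Nat.lt_of_succ_lt hk⟩, i⟩ -
        XF n (mEta n) ⟨⟨k, Nat.lt_of_succ_lt hk⟩, j⟩))

/-- The Gelfand–Tsetlin function e⁻_{k,i} ∈ K (0-based row k, 0 ≤ k ≤ n-2). -/
def eMinus (k : ℕ) (hk : k + 1 < n) (i : Fin (k + 1)) : KK n :=
  (∏ j : Fin k,
      (XF n (mEta n) ⟨⟨k, Nat.lt_of_succ_lt hk⟩, i⟩ -
        XF n (mEta n) ⟨⟨k - 1, by omega⟩, Fin.castLE (by simp only [mEta]; omega) j⟩)) /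
  (∏ j ∈ Finset.univ.erase i,
      (XF n (mEta n) ⟨⟨k, Nat.lt_of_succ_lt hk⟩, i⟩ -
        XF n (mEta n) ⟨⟨k, Nat.lt_of_succ_lt hk⟩, j⟩))

/-- The Gelfand–Tsetlin operator E_{k,k+1} (0-based: matrix unit (k, k+1)). -/
def Eop (k : ℕ) (hk : k + 1 < n) : Module.End (KK n) (VK n) :=
  Finsupp.lsum (KK n) fun z => LinearMap.toSpanSingleton (KK n) (VK n)
    (-∑ i : Fin (k + 1),
      shiftK n (z : IdxN n → ℤ) (ePlus n k hk i) • T n (z + deltaZ n k hk i))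

/-- The Gelfand–Tsetlin operator E_{k+1,k} (0-based: matrix unit (k+1, k)). -/
def Fop (k : ℕ) (hk : k + 1 < n) : Module.End (KK n) (VK n) :=
  Finsupp.lsum (KK n) fun z => LinearMap.toSpanSingleton (KK n) (VK n)
    (∑ i : Fin (k + 1),
      shiftK n (z : IdxN n → ℤ) (eMinus n k hk i) • T n (z - deltaZ n k hk i))

/-- The Gelfand–Tsetlin operator E_{k,k} (0-based row k of the diagonal). -/
def Hop (k : Fin n) : Module.End (KK n) (VK n) :=
  Finsupp.lsum (KK n) fun z => LinearMap.toSpanSingleton (KK n) (VK n)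
    (((∑ j : Fin ((k : ℕ) + 1),
        (XF n (mEta n) ⟨k, j⟩ + ((z : IdxN n → ℤ) ⟨k, j⟩ : KK n))) -
      (∑ j : Fin (k : ℕ),
        (XF n (mEta n) ⟨⟨(k : ℕ) - 1, by omega⟩, Fin.castLE (by simp only [mEta]; omega) j⟩ +
          ((z : IdxN n → ℤ) ⟨⟨(k : ℕ) - 1, by omega⟩, Fin.castLE (by simp only [mEta]; omega) j⟩ : KK n))) +
      ((k : ℕ) : KK n)) • T n z)

/-- The action of S_μ on ℤ^μ_0. -/
def permZ0 (σ : SgN n) : Z0 n ≃ Z0 n where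
  toFun z := ⟨fun p => (z : IdxN n → ℤ) ((permIdx n (mEta n) σ).symm p), by
    intro p hp
    exact z.2 ((permIdx n (mEta n) σ).symm p) hp⟩
  invFun z := ⟨fun p => (z : IdxN n → ℤ) (permIdx n (mEta n) σ p), by
    intro p hp
    exact z.2 (permIdx n (mEta n) σ p) hp⟩
  left_inv z := by ext p; simp
  right_inv z := by ext p; simp

/-- The diagonal action of S_μ on V_K : σ·(f T(z)) = σ(f) T(σ(z)). -/
def sact (σ : SgN n) (w : VK n) : VK n :=
  Finsupp.equivMapDomain (permZ0 n σ) (Finsupp.mapRange (actF n (mEta n) σ) (map_zero _) w)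
/-! ### Refinements η of μ, given by a block function on the index set -/

variable (blk : IdxN n → ℕ)

/-- The subgroup S_η ⊆ S_μ of permutations preserving each η-block. -/
def SgEta : Subgroup (SgN n) where
  carrier := {σ | ∀ p : IdxN n, blk (permIdx n (mEta n) σ p) = blk p}
  one_mem' := fun _ => rfl
  mul_mem' := by
    intro a b ha hb p
    exact (ha (permIdx n (mEta n) b p)).trans (hb p)
  inv_mem' := by
    intro a ha p
    have h := ha (permIdx n (mEta n) a⁻¹ p)
    simpa [permIdx] using h.symm

/-- η! : the order of S_η (the product of the factorials of the parts of η). -/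
def etaFactB : ℕ := Nat.card ↥(SgEta n blk)

/-- The symmetrization operator sym_η on K. -/
noncomputable def symK (f : KK n) : KK n :=
  haveI : Fintype ↥(SgEta n blk) := Fintype.ofFinite _
  (etaFactB n blk : KK n)⁻¹ * ∑ τ : ↥(SgEta n blk), actF n (mEta n) (τ : SgN n) f

/-- The symmetrization operator sym_η on V_K (for the diagonal action). -/
noncomputable def symV (x : VK n) : VK n :=
  haveI : Fintype ↥(SgEta n blk) := Fintype.ofFinite _
  (etaFactB n blk : KK n)⁻¹ • ∑ τ : ↥(SgEta n blk), sact n (τ : SgN n) x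

/-- The divided difference operator ∂_i^{(k)} acting on V_K via the diagonal action. -/
noncomputable def ddV (k : Fin n) (i : ℕ) (h : i + 1 < mEta n k) (x : VK n) : VK n :=
  (XF n (mEta n) ⟨k, ⟨i, Nat.lt_of_succ_lt h⟩⟩ - XF n (mEta n) ⟨k, ⟨i + 1, h⟩⟩)⁻¹ •
    (x - sact n (simpleT n (mEta n) k i h) x)

/-- The composite of divided differences on V_K along a word. -/
noncomputable def ddWordV (w : Word n (mEta n)) (x : VK n) : VK n :=
  w.foldr (fun s g => ddV n s.1 s.2.1 s.2.2 g) x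

/-- All letters of the word are simple transpositions inside η-blocks (i.e. lie in S_η). -/
def WordBlk (w : Word n (mEta n)) : Prop :=
  ∀ s ∈ w, blk ⟨s.1, ⟨s.2.1, Nat.lt_of_succ_lt s.2.2⟩⟩ = blk ⟨s.1, ⟨s.2.1 + 1, s.2.2⟩⟩

/-- `w` is a reduced decomposition of σ into simple transpositions of S_η. -/
def IsRedB (σ : SgN n) (w : Word n (mEta n)) : Prop :=
  IsRed n (mEta n) σ w ∧ WordBlk n blk w

/-- The multiplicative set of ℂ[X_μ] generated by the x_{k,i} − x_{k,j} − c (c a nonzero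
integer, row k below the top) and by the x_{k,i} − x_{k,j} with (k,i), (k,j) in different
η-blocks. -/
def BMon : Submonoid (PolN n) :=
  Submonoid.closure
    ({q | ∃ (k : Fin n) (i j : Fin ((k : ℕ) + 1)) (c : ℤ), (k : ℕ) + 1 < n ∧ i < j ∧ c ≠ 0 ∧
        q = MvPolynomial.X (⟨k, i⟩ : IdxN n) - MvPolynomial.X (⟨k, j⟩ : IdxN n) -
          MvPolynomial.C (c : ℂ)} ∪
     {q | ∃ (k : Fin n) (i j : Fin ((k : ℕ) + 1)), blk ⟨k, i⟩ ≠ blk ⟨k, j⟩ ∧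
        q = MvPolynomial.X (⟨k, i⟩ : IdxN n) - MvPolynomial.X (⟨k, j⟩ : IdxN n)})

/-- The algebra B_η ⊆ K : the localization of ℂ[X_μ] at the multiplicative set `BMon`,
viewed as the subalgebra of K of fractions with denominator in `BMon`. -/
def Balg : Subalgebra ℂ (KK n) where
  carrier := {f | ∃ p : PolN n, ∃ q ∈ BMon n blk,
    f * algebraMap (PolN n) (KK n) q = algebraMap (PolN n) (KK n) p}
  mul_mem' := by
    rintro f g ⟨p₁, q₁, hq₁, h₁⟩ ⟨p₂, q₂, hq₂, h₂⟩
    refine ⟨p₁ * p₂, q₁ * q₂, mul_mem hq₁ hq₂, ?_⟩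
    have : f * g * algebraMap (PolN n) (KK n) (q₁ * q₂) =
        (f * algebraMap (PolN n) (KK n) q₁) * (g * algebraMap (PolN n) (KK n) q₂) := by
      rw [map_mul]; ring
    rw [this, h₁, h₂, ← map_mul]
  one_mem' := ⟨1, 1, one_mem _, by simp⟩
  add_mem' := by
    rintro f g ⟨p₁, q₁, hq₁, h₁⟩ ⟨p₂, q₂, hq₂, h₂⟩
    refine ⟨p₁ * q₂ + p₂ * q₁, q₁ * q₂, mul_mem hq₁ hq₂, ?_⟩
    have : (f + g) * algebraMap (PolN n) (KK n) (q₁ * q₂) =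
        (f * algebraMap (PolN n) (KK n) q₁) * algebraMap (PolN n) (KK n) q₂ +
        (g * algebraMap (PolN n) (KK n) q₂) * algebraMap (PolN n) (KK n) q₁ := by
      rw [map_mul]; ring
    rw [this, h₁, h₂, ← map_mul, ← map_mul, ← map_add]
  zero_mem' := ⟨0, 1, one_mem _, by simp⟩
  algebraMap_mem' := by
    intro c
    refine ⟨MvPolynomial.C c, 1, one_mem _, ?_⟩
    rw [map_one, mul_one, IsScalarTower.algebraMap_apply ℂ (PolN n) (KK n)]
    simp [MvPolynomial.algebraMap_eq]

/-- The set N_η of integral points which are weakly decreasing along each η-block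
(normal-form representatives of the S_η-orbits). -/
def Nset : Set (Z0 n) :=
  {z | ∀ (k : Fin n) (i j : Fin ((k : ℕ) + 1)), i ≤ j → blk ⟨k, i⟩ = blk ⟨k, j⟩ →
    (z : IdxN n → ℤ) ⟨k, j⟩ ≤ (z : IdxN n → ℤ) ⟨k, i⟩}

/-- σ is an ε(z)-shuffle: σ ∈ S_η and σ is increasing on each ε(z)-block, where ε(z) is
the refinement of η whose blocks are the runs of equal entries of z inside the η-blocks
(so S_{ε(z)} is the stabilizer of z in S_η). -/
def IsShuffle (z : Z0 n) (σ : SgN n) : Prop :=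
  σ ∈ SgEta n blk ∧
    ∀ (k : Fin n) (i j : Fin ((k : ℕ) + 1)), i < j → blk ⟨k, i⟩ = blk ⟨k, j⟩ →
      (z : IdxN n → ℤ) ⟨k, i⟩ = (z : IdxN n → ℤ) ⟨k, j⟩ → σ k i < σ k j

/-- The index set for the basis of derived tableaux. -/
def BIdx : Type :=
  {x : Z0 n × SgN n // x.1 ∈ Nset n blk ∧ IsShuffle n blk x.1 x.2}

/-- The operator c_γ on V_K, given by c_γ T(z) = γ(x+z) T(z). -/
noncomputable def copN (γ : PolN n) : Module.End (KK n) (VK n) :=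
  Finsupp.lsum (KK n) fun z => LinearMap.toSpanSingleton (KK n) (VK n)
    (shiftK n (z : IdxN n → ℤ) (algebraMap (PolN n) (KK n) γ) • T n z)

/-- Evaluation γ(v+z) of a polynomial at the point v + z. -/
noncomputable def evalVZ (v : IdxN n → ℂ) (z : Z0 n) (γ : PolN n) : ℂ :=
  MvPolynomial.eval (fun p => v p + ((z : IdxN n → ℤ) p : ℂ)) γ

section Actions

theorem actF_algebraMap (σ : Sg r η) (p : Pol r η) :
    actF r η σ (algebraMap (Pol r η) (FF r η) p) =
      algebraMap (Pol r η) (FF r η) (actP r η σ p) :=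
  IsFractionRing.ringEquivOfRingEquiv_algebraMap _ _

theorem actP_X (σ : Sg r η) (p : Idx r η) :
    actP r η σ (MvPolynomial.X p) = MvPolynomial.X (permIdx r η σ p) := by
  simp [actP]

theorem actP_C (σ : Sg r η) (c : ℂ) :
    actP r η σ (MvPolynomial.C c) = MvPolynomial.C c := by
  simp [actP]

theorem actF_XF (σ : Sg r η) (p : Idx r η) :
    actF r η σ (XF r η p) = XF r η (permIdx r η σ p) := by
  rw [XF, actF_algebraMap, actP_X]; rfl

theorem permIdx_mul (σ τ : Sg r η) (p : Idx r η) :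
    permIdx r η (σ * τ) p = permIdx r η σ (permIdx r η τ p) := rfl

theorem actP_mul (σ τ : Sg r η) (p : Pol r η) :
    actP r η (σ * τ) p = actP r η σ (actP r η τ p) := by
  have h : (permIdx r η (σ * τ) : Idx r η → Idx r η) = permIdx r η σ ∘ permIdx r η τ := rfl
  simp [actP, MvPolynomial.rename_rename, h]

theorem actF_mul (σ τ : Sg r η) (f : FF r η) :
    actF r η (σ * τ) f = actF r η σ (actF r η τ f) := by
  have h : (actF r η (σ * τ)).toRingHom =
      (actF r η σ).toRingHom.comp (actF r η τ).toRingHom := by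
    refine IsLocalization.ringHom_ext (nonZeroDivisors (Pol r η)) (RingHom.ext fun p => ?_)
    simp [actF_algebraMap, actP_mul]
  exact DFunLike.congr_fun h f

theorem actF_one (f : FF r η) : actF r η 1 f = f := by
  have h := actF_mul r η 1 1 f
  rw [mul_one] at h
  exact ((actF r η 1).injective h).symm

theorem XF_injective : Function.Injective (XF r η) :=
  (IsFractionRing.injective (Pol r η) (FF r η)).comp (MvPolynomial.X_injective)

theorem actF_injective : Function.Injective fun σ : Sg r η => (actF r η σ : FF r η → FF r η) := by
  intro σ τ h
  funext k
  ext i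
  have h1 := congrFun h (XF r η ⟨k, i⟩)
  simp only [actF_XF] at h1
  have h2 := XF_injective r η h1
  have h3 : (⟨k, σ k i⟩ : Idx r η) = ⟨k, τ k i⟩ := h2
  simpa [Fin.ext_iff] using h3

theorem permZ0_apply (σ : SgN n) (z : Z0 n) (k : Fin n) (i : Fin ((k : ℕ) + 1)) :
    (permZ0 n σ z : IdxN n → ℤ) ⟨k, i⟩ = (z : IdxN n → ℤ) ⟨k, (σ k)⁻¹ i⟩ := rfl

theorem permZ0_mul (σ τ : SgN n) (z : Z0 n) :
    permZ0 n (σ * τ) z = permZ0 n σ (permZ0 n τ z) := by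
  ext ⟨k, i⟩
  simp [permZ0_apply]

theorem sact_T (σ : SgN n) (z : Z0 n) : sact n σ (T n z) = T n (permZ0 n σ z) := by
  unfold sact T
  rw [Finsupp.mapRange_single, map_one, Finsupp.equivMapDomain_single]

theorem sact_add (σ : SgN n) (x y : VK n) : sact n σ (x + y) = sact n σ x + sact n σ y := by
  refine Finsupp.ext fun z => ?_
  exact map_add (actF n (mEta n) σ) _ _

theorem sact_smul (σ : SgN n) (f : KK n) (x : VK n) :
    sact n σ (f • x) = actF n (mEta n) σ f • sact n σ x := by
  refine Finsupp.ext fun z => ?_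
  exact map_mul (actF n (mEta n) σ) _ _

theorem sact_mul (σ τ : SgN n) (x : VK n) : sact n (σ * τ) x = sact n σ (sact n τ x) := by
  refine Finsupp.ext fun z => ?_
  have h : (permZ0 n (σ * τ)).symm z = (permZ0 n τ).symm ((permZ0 n σ).symm z) := by
    rw [Equiv.symm_apply_eq, permZ0_mul]; simp
  change actF n (mEta n) (σ * τ) (Finsupp.toFun x ((permZ0 n (σ * τ)).symm z)) = _
  rw [actF_mul, h]
  rfl

/-- The action of an element of S_μ on V_K as an additive map. -/
def sactHom (σ : SgN n) : VK n →+ VK n := AddMonoidHom.mk' (sact n σ) (sact_add n σ)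

theorem sact_neg (σ : SgN n) (x : VK n) : sact n σ (-x) = -sact n σ x :=
  map_neg (sactHom n σ) x

theorem sact_sub (σ : SgN n) (x y : VK n) : sact n σ (x - y) = sact n σ x - sact n σ y :=
  map_sub (sactHom n σ) x y

theorem sact_sum {ι : Type*} (s : Finset ι) (σ : SgN n) (x : ι → VK n) :
    sact n σ (∑ i ∈ s, x i) = ∑ i ∈ s, sact n σ (x i) :=
  map_sum (sactHom n σ) x s

end Actions

section Length

/-- The set of inversions of a permutation. -/
def invSet {m : ℕ} (σ : Equiv.Perm (Fin m)) : Finset (Fin m × Fin m) :=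
  Finset.univ.filter fun p => p.1 < p.2 ∧ σ p.2 < σ p.1

theorem mem_invSet {m : ℕ} {σ : Equiv.Perm (Fin m)} {p : Fin m × Fin m} :
    p ∈ invSet σ ↔ p.1 < p.2 ∧ σ p.2 < σ p.1 := by
  simp [invSet]

theorem card_invSet_inv {m : ℕ} (σ : Equiv.Perm (Fin m)) :
    (invSet σ⁻¹).card = (invSet σ).card := by
  refine Finset.card_bij' (fun p _ => (σ⁻¹ p.2, σ⁻¹ p.1)) (fun p _ => (σ p.2, σ p.1))
    ?_ ?_ ?_ ?_ <;> simp +contextual [mem_invSet]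

theorem swap_lt_swap {m : ℕ} {i j : Fin m} (hij : (j : ℕ) = i + 1) {a b : Fin m}
    (hab : a < b) (h : ¬ (a = i ∧ b = j)) : Equiv.swap i j a < Equiv.swap i j b := by
  simp only [Equiv.swap_apply_def, Fin.ext_iff, Fin.lt_def] at *
  split_ifs <;> omega

theorem card_invSet_mul_swap {m : ℕ} (σ : Equiv.Perm (Fin m)) {i j : Fin m}
    (hij : (j : ℕ) = i + 1) (h : σ i < σ j) :
    (invSet (σ * Equiv.swap i j)).card = (invSet σ).card + 1 := by
  have hlt : i < j := by rw [Fin.lt_def]; omega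
  have hmem : (i, j) ∈ invSet (σ * Equiv.swap i j) := by
    simp [mem_invSet, hlt, h]
  have hne : ∀ p ∈ invSet σ, ¬ (p.1 = i ∧ p.2 = j) := by
    rintro ⟨a, b⟩ hp ⟨rfl, rfl⟩
    exact absurd h (not_lt.mpr (mem_invSet.1 hp).2.le)
  rw [← Finset.card_erase_add_one hmem]
  congr 1
  refine Finset.card_bij' (fun p _ => (Equiv.swap i j p.1, Equiv.swap i j p.2))
    (fun p _ => (Equiv.swap i j p.1, Equiv.swap i j p.2)) ?_ ?_ ?_ ?_
  · rintro ⟨a, b⟩ hp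
    rw [Finset.mem_erase, mem_invSet] at hp
    rw [mem_invSet]
    refine ⟨swap_lt_swap hij hp.2.1 fun h => hp.1 (Prod.ext h.1 h.2), hp.2.2⟩
  · rintro ⟨a, b⟩ hp
    have h1 := hne _ hp
    rw [mem_invSet] at hp
    rw [Finset.mem_erase, mem_invSet]
    refine ⟨fun hE => ?_, swap_lt_swap hij hp.1 h1, by simpa using hp.2⟩
    rw [Prod.ext_iff] at hE
    have ha : a = j := by simpa using congrArg (Equiv.swap i j) hE.1
    have hb : b = i := by simpa using congrArg (Equiv.swap i j) hE.2
    exact absurd hp.1 (by simp [ha, hb, hlt.le])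
  · simp
  · simp

theorem len_eq (σ : Sg r η) : len r η σ = ∑ k, (invSet (σ k)).card := rfl

theorem len_inv (σ : Sg r η) : len r η σ⁻¹ = len r η σ := by
  simp only [len_eq, Pi.inv_apply, card_invSet_inv]

theorem len_one : len r η 1 = 0 := by
  simp only [len_eq, Pi.one_apply, Finset.sum_eq_zero_iff, Finset.card_eq_zero]
  rintro k -
  ext p
  simpa [mem_invSet] using fun h => h.le

theorem simpleT_mul_self (k : Fin r) (i : ℕ) (h : i + 1 < η k) :
    simpleT r η k i h * simpleT r η k i h = 1 := by
  funext j
  by_cases hj : j = k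
  · subst hj; simp [simpleT, transpT]
  · simp [simpleT, transpT, hj]

theorem simpleT_inv (k : Fin r) (i : ℕ) (h : i + 1 < η k) :
    (simpleT r η k i h)⁻¹ = simpleT r η k i h :=
  inv_eq_of_mul_eq_one_right (simpleT_mul_self r η k i h)

theorem simpleT_same (k : Fin r) (i : ℕ) (h : i + 1 < η k) :
    simpleT r η k i h k = Equiv.swap ⟨i, Nat.lt_of_succ_lt h⟩ ⟨i + 1, h⟩ := by
  simp [simpleT, transpT]

theorem simpleT_of_ne {k j : Fin r} (i : ℕ) (h : i + 1 < η k) (hj : j ≠ k) :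
    simpleT r η k i h j = 1 := by
  simp [simpleT, transpT, hj]

theorem len_mul_simpleT {σ : Sg r η} {k : Fin r} {i : ℕ} {h : i + 1 < η k}
    (hlt : σ k ⟨i, Nat.lt_of_succ_lt h⟩ < σ k ⟨i + 1, h⟩) :
    len r η (σ * simpleT r η k i h) = len r η σ + 1 := by
  simp only [len_eq, Pi.mul_apply]
  rw [← Finset.add_sum_erase _ _ (Finset.mem_univ k),
    ← Finset.add_sum_erase Finset.univ (fun k => (invSet (σ k)).card) (Finset.mem_univ k),
    simpleT_same, card_invSet_mul_swap _ rfl hlt]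
  have : ∀ j ∈ Finset.univ.erase k,
      (invSet (σ j * simpleT r η k i h j)).card = (invSet (σ j)).card := by
    intro j hj
    rw [simpleT_of_ne r η i h (Finset.ne_of_mem_erase hj), mul_one]
  rw [Finset.sum_congr rfl this]
  ring

theorem len_mul_simpleT_of_gt {σ : Sg r η} {k : Fin r} {i : ℕ} {h : i + 1 < η k}
    (hlt : σ k ⟨i + 1, h⟩ < σ k ⟨i, Nat.lt_of_succ_lt h⟩) :
    len r η (σ * simpleT r η k i h) + 1 = len r η σ := by
  rw [← len_mul_simpleT r η (σ := σ * simpleT r η k i h) (k := k) (i := i) (h := h),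
    mul_assoc, simpleT_mul_self, mul_one]
  simpa [simpleT_same] using hlt

theorem len_mul_simpleT_cases (σ : Sg r η) (k : Fin r) (i : ℕ) (h : i + 1 < η k) :
    len r η (σ * simpleT r η k i h) = len r η σ + 1 ∨
      len r η (σ * simpleT r η k i h) + 1 = len r η σ := by
  rcases lt_or_gt_of_ne (show σ k ⟨i, Nat.lt_of_succ_lt h⟩ ≠ σ k ⟨i + 1, h⟩ by simp) with h' | h'
  · exact Or.inl (len_mul_simpleT r η h')
  · exact Or.inr (len_mul_simpleT_of_gt r η h')

theorem len_simpleT_mul_cases (σ : Sg r η) (k : Fin r) (i : ℕ) (h : i + 1 < η k) :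
    len r η (simpleT r η k i h * σ) = len r η σ + 1 ∨
      len r η (simpleT r η k i h * σ) + 1 = len r η σ := by
  have := len_mul_simpleT_cases r η σ⁻¹ k i h
  rwa [← len_inv r η (σ⁻¹ * _), mul_inv_rev, inv_inv, simpleT_inv, len_inv] at this

theorem exists_descent {m : ℕ} {f : Fin m → ℕ} {i j : Fin m} (hij : i < j) (h : f j < f i) :
    ∃ (a : ℕ) (ha : a + 1 < m), (i : ℕ) ≤ a ∧ a + 1 ≤ j ∧
      f ⟨a + 1, ha⟩ < f ⟨a, Nat.lt_of_succ_lt ha⟩ := by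
  by_contra! hcon
  have key : ∀ d : ℕ, ∀ hd : (i : ℕ) + d < m, (i : ℕ) + d ≤ j → f i ≤ f ⟨i + d, hd⟩ := by
    intro d
    induction d with
    | zero => intro _ _; exact le_rfl
    | succ d ih =>
      intro hd hle
      exact (ih (by omega) (by omega)).trans (hcon (i + d) (by omega) (by omega) (by omega))
  have h1 := key (j - i) (by omega) (by omega)
  have h2 : (⟨(i : ℕ) + (j - i), by omega⟩ : Fin m) = j := by
    ext; simp only; omega
  rw [h2] at h1
  omega

theorem perm_eq_one_of_strictMono {m : ℕ} {σ : Equiv.Perm (Fin m)} (h : StrictMono σ) : σ = 1 := by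
  have : (StrictMono.orderIsoOfSurjective σ h σ.surjective) = OrderIso.refl _ :=
    Subsingleton.elim _ _
  ext i
  exact congrArg Fin.val (DFunLike.congr_fun this i)

end Length

section ReducedWords

/-- The letter `s` is a simple transposition of two entries of the same η-block. -/
def LetterBlk (s : SimpleDat n (mEta n)) : Prop :=
  blk ⟨s.1, ⟨s.2.1, Nat.lt_of_succ_lt s.2.2⟩⟩ = blk ⟨s.1, ⟨s.2.1 + 1, s.2.2⟩⟩

/-- The simple transposition attached to a letter. -/
def letterT (s : SimpleDat n (mEta n)) : SgN n := simpleT n (mEta n) s.1 s.2.1 s.2.2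

/-- The divided difference operator on V_K attached to a letter. -/
def ddL (s : SimpleDat n (mEta n)) (x : VK n) : VK n := ddV n s.1 s.2.1 s.2.2 x

theorem mem_SgEta {σ : SgN n} :
    σ ∈ SgEta n blk ↔ ∀ (k : Fin n) (i : Fin ((k : ℕ) + 1)), blk ⟨k, σ k i⟩ = blk ⟨k, i⟩ :=
  ⟨fun h k i => h ⟨k, i⟩, fun h p => h p.1 p.2⟩

variable {n blk}

theorem letterT_mem {s : SimpleDat n (mEta n)} (hs : LetterBlk n blk s) :
    letterT n s ∈ SgEta n blk := by
  rw [mem_SgEta]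
  intro k i
  by_cases hk : k = s.1
  · subst hk
    rw [letterT, simpleT_same, Equiv.swap_apply_def]
    split_ifs with h1 h2
    · rw [h1]; exact hs.symm
    · rw [h2]; exact hs
    · rfl
  · rw [letterT, simpleT_of_ne n (mEta n) _ _ hk]
    rfl

theorem wordPerm_cons (s : SimpleDat n (mEta n)) (w : Word n (mEta n)) :
    wordPerm n (mEta n) (s :: w) = letterT n s * wordPerm n (mEta n) w := by
  simp [wordPerm, letterT]

theorem wordPerm_append (v w : Word n (mEta n)) :
    wordPerm n (mEta n) (v ++ w) = wordPerm n (mEta n) v * wordPerm n (mEta n) w := by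
  simp [wordPerm]

theorem wordPerm_mem {w : Word n (mEta n)} (hw : WordBlk n blk w) :
    wordPerm n (mEta n) w ∈ SgEta n blk := by
  induction w with
  | nil => exact one_mem _
  | cons s w ih =>
    rw [wordPerm_cons]
    exact mul_mem (letterT_mem (hw s List.mem_cons_self))
      (ih fun t ht => hw t (List.mem_cons_of_mem s ht))

theorem ddWordV_cons (s : SimpleDat n (mEta n)) (w : Word n (mEta n)) (x : VK n) :
    ddWordV n (s :: w) x = ddL n s (ddWordV n w x) := rfl

theorem ddWordV_append (v w : Word n (mEta n)) (x : VK n) :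
    ddWordV n (v ++ w) x = ddWordV n v (ddWordV n w x) :=
  List.foldr_append

theorem isRedB_append_of_descent {σ : SgN n} {s : SimpleDat n (mEta n)} (hs : LetterBlk n blk s)
    (hlen : len n (mEta n) (σ * letterT n s) + 1 = len n (mEta n) σ) {w : Word n (mEta n)}
    (hw : IsRedB n blk (σ * letterT n s) w) : IsRedB n blk σ (w ++ [s]) := by
  obtain ⟨⟨hw1, hw2⟩, hw3⟩ := hw
  refine ⟨⟨?_, ?_⟩, ?_⟩
  · rw [wordPerm_append, hw1, wordPerm_cons]
    change σ * letterT n s * (letterT n s * 1) = σ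
    rw [mul_one, mul_assoc, letterT, simpleT_mul_self, mul_one]
  · rw [List.length_append, hw2, ← hlen]
    rfl
  · intro t ht
    rcases List.mem_append.1 ht with h | h
    · exact hw3 t h
    · rw [List.mem_singleton.1 h]; exact hs

section Monotone

variable (hmono : ∀ k : Fin n, Monotone fun i : Fin ((k : ℕ) + 1) => blk ⟨k, i⟩)
include hmono

theorem blk_eq_of_descent {σ : SgN n} (hσ : σ ∈ SgEta n blk) {k : Fin n}
    {i j : Fin ((k : ℕ) + 1)} (hij : i < j) (h : σ k j < σ k i) : blk ⟨k, i⟩ = blk ⟨k, j⟩ := by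
  rw [mem_SgEta] at hσ
  have h1 : blk ⟨k, i⟩ ≤ blk ⟨k, j⟩ := hmono k hij.le
  have h2 : blk ⟨k, σ k j⟩ ≤ blk ⟨k, σ k i⟩ := hmono k h.le
  rw [hσ, hσ] at h2
  exact le_antisymm h1 h2

theorem exists_letter_of_gt {σ : SgN n} (hσ : σ ∈ SgEta n blk) {k : Fin n}
    {i j : Fin ((k : ℕ) + 1)} (hij : i < j) (h : σ k j < σ k i) :
    ∃ s : SimpleDat n (mEta n), LetterBlk n blk s ∧
      len n (mEta n) (σ * letterT n s) + 1 = len n (mEta n) σ ∧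
      s.1 = k ∧ (i : ℕ) ≤ s.2.1 ∧ s.2.1 + 1 ≤ (j : ℕ) := by
  obtain ⟨a, ha, hia, haj, hdesc⟩ :=
    exists_descent (f := fun a => (σ k a : ℕ)) hij (by exact_mod_cast h)
  refine ⟨⟨k, a, ha⟩, ?_, ?_, rfl, hia, haj⟩
  · exact blk_eq_of_descent hmono hσ (by rw [Fin.lt_def]; simp) (Fin.lt_def.2 hdesc)
  · exact len_mul_simpleT_of_gt n (mEta n) (Fin.lt_def.2 hdesc)

theorem exists_isRedB {σ : SgN n} (hσ : σ ∈ SgEta n blk) : ∃ w, IsRedB n blk σ w := by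
  induction hl : len n (mEta n) σ generalizing σ with
  | zero =>
    have h1 : σ = 1 := by
      funext k
      refine perm_eq_one_of_strictMono fun i j hij => ?_
      by_contra hcon
      have hlt : σ k j < σ k i :=
        lt_of_le_of_ne (not_lt.1 hcon) ((σ k).injective.ne hij.ne')
      obtain ⟨s, -, hs, -⟩ := exists_letter_of_gt hmono hσ hij hlt
      omega
    exact ⟨[], ⟨h1.symm, hl.symm⟩, fun s hs => by simp at hs⟩
  | succ l ih =>
    have h1 : ∃ (k : Fin n) (i j : Fin ((k : ℕ) + 1)), i < j ∧ σ k j < σ k i := by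
      by_contra! hcon
      have : σ = 1 := by
        funext k
        refine perm_eq_one_of_strictMono fun i j hij => ?_
        exact lt_of_le_of_ne (hcon k i j hij) ((σ k).injective.ne hij.ne)
      rw [this, len_one] at hl
      omega
    obtain ⟨k, i, j, hij, hlt⟩ := h1
    obtain ⟨s, hs, hlen, -⟩ := exists_letter_of_gt hmono hσ hij hlt
    obtain ⟨w, hw⟩ := ih (mul_mem hσ (letterT_mem hs)) (by omega)
    exact ⟨w ++ [s], isRedB_append_of_descent hs hlen hw⟩

end Monotone

variable (n) in
/-- The difference of variables `x_{k,i} - x_{k,i+1}` attached to a letter. -/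
def alphaL (s : SimpleDat n (mEta n)) : KK n :=
  XF n (mEta n) ⟨s.1, ⟨s.2.1, Nat.lt_of_succ_lt s.2.2⟩⟩ -
    XF n (mEta n) ⟨s.1, ⟨s.2.1 + 1, s.2.2⟩⟩

theorem alphaL_ne_zero (s : SimpleDat n (mEta n)) : alphaL n s ≠ 0 := by
  intro h
  have := XF_injective n (mEta n) (sub_eq_zero.1 h)
  simp at this

theorem actF_alphaL (s : SimpleDat n (mEta n)) :
    actF n (mEta n) (letterT n s) (alphaL n s) = -alphaL n s := by
  rw [alphaL, map_sub, actF_XF, actF_XF, neg_sub]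
  simp [permIdx, letterT, simpleT_same]

theorem ddL_eq (s : SimpleDat n (mEta n)) (x : VK n) :
    ddL n s x = (alphaL n s)⁻¹ • (x - sact n (letterT n s) x) := rfl

theorem letterT_mul_self (s : SimpleDat n (mEta n)) : letterT n s * letterT n s = 1 :=
  simpleT_mul_self _ _ _ _ _

theorem sact_one (x : VK n) : sact n 1 x = x := by
  refine Finsupp.ext fun z => ?_
  change actF n (mEta n) 1 (Finsupp.toFun x z) = Finsupp.toFun x z
  exact actF_one _ _ _

theorem ddL_ddL (s : SimpleDat n (mEta n)) (x : VK n) : ddL n s (ddL n s x) = 0 := by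
  have h : sact n (letterT n s) (ddL n s x) = ddL n s x := by
    have hinv : (-alphaL n s)⁻¹ = -(alphaL n s)⁻¹ := inv_neg
    rw [ddL_eq, sact_smul, sact_sub, ← sact_mul, letterT_mul_self, sact_one, map_inv₀,
      actF_alphaL, hinv, neg_smul, ← smul_neg, neg_sub]
  rw [ddL_eq, h, sub_self, smul_zero]

theorem ddL_zero (s : SimpleDat n (mEta n)) : ddL n s 0 = 0 := by
  rw [ddL_eq, show sact n (letterT n s) 0 = 0 from map_zero (sactHom n _), sub_zero, smul_zero]

theorem ddWordV_zero (w : Word n (mEta n)) : ddWordV n w 0 = 0 := by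
  induction w with
  | nil => rfl
  | cons s w ih => rw [ddWordV_cons, ih, ddL_zero]

section Family

variable (hmono : ∀ k : Fin n, Monotone fun i : Fin ((k : ℕ) + 1) => blk ⟨k, i⟩)
variable {PdV : SgN n → VK n → VK n}
variable (hPdV : ∀ σ ∈ SgEta n blk, ∀ w : Word n (mEta n), IsRedB n blk σ w →
      ∀ x : VK n, PdV σ x = ddWordV n w x)
include hmono hPdV

theorem isRedB_or_ddWordV_eq_zero {w : Word n (mEta n)} (hw : WordBlk n blk w) :
    IsRedB n blk (wordPerm n (mEta n) w) w ∨ ∀ x, ddWordV n w x = 0 := by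
  induction w with
  | nil => exact Or.inl ⟨⟨rfl, (len_one n (mEta n)).symm⟩, hw⟩
  | cons s w ih =>
    have hs : LetterBlk n blk s := hw s List.mem_cons_self
    have hw' : WordBlk n blk w := fun t ht => hw t (List.mem_cons_of_mem s ht)
    rcases ih hw' with h | h
    · rcases len_simpleT_mul_cases n (mEta n) (wordPerm n (mEta n) w) s.1 s.2.1 s.2.2 with hl | hl
      · refine Or.inl ⟨⟨rfl, ?_⟩, hw⟩
        rw [wordPerm_cons, List.length_cons, h.1.2]
        exact hl.symm
      · refine Or.inr fun x => ?_
        obtain ⟨v, ⟨hv1, hv2⟩, hv3⟩ :=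
          exists_isRedB hmono (mul_mem (letterT_mem hs) (wordPerm_mem hw'))
        have hred : IsRedB n blk (wordPerm n (mEta n) w) (s :: v) := by
          refine ⟨⟨?_, ?_⟩, ?_⟩
          · rw [wordPerm_cons, hv1, ← mul_assoc, letterT_mul_self, one_mul]
          · rw [List.length_cons, hv2]
            exact hl
          · intro t ht
            rcases List.mem_cons.1 ht with rfl | ht
            · exact hs
            · exact hv3 t ht
        rw [ddWordV_cons, ← hPdV _ (wordPerm_mem hw') _ h, hPdV _ (wordPerm_mem hw') _ hred,
          ddWordV_cons, ddL_ddL]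
    · exact Or.inr fun x => by rw [ddWordV_cons, h, ddL_zero]

theorem exists_ddWordV_bound : ∃ l : ℕ, ∀ w : Word n (mEta n), WordBlk n blk w → l < w.length →
    ∀ x, ddWordV n w x = 0 := by
  refine ⟨∑ σ, len n (mEta n) σ, fun w hw hl => ?_⟩
  refine (isRedB_or_ddWordV_eq_zero hmono hPdV hw).resolve_left fun h => ?_
  have := Finset.single_le_sum (f := len n (mEta n)) (fun _ _ => Nat.zero_le _)
    (Finset.mem_univ (wordPerm n (mEta n) w))
  have h2 := h.1.2
  omega

theorem PdV_T_eq_zero {z : Z0 n} (hz : z ∈ Nset n blk) {σ : SgN n} (hσ : σ ∈ SgEta n blk)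
    (hsh : ¬ IsShuffle n blk z σ) : PdV σ (T n z) = 0 := by
  have h1 : ∃ (k : Fin n) (i j : Fin ((k : ℕ) + 1)), i < j ∧ blk ⟨k, i⟩ = blk ⟨k, j⟩ ∧
      (z : IdxN n → ℤ) ⟨k, i⟩ = (z : IdxN n → ℤ) ⟨k, j⟩ ∧ σ k j ≤ σ k i := by
    by_contra! hcon
    exact hsh ⟨hσ, hcon⟩
  obtain ⟨k, i, j, hij, hb, hze, hle⟩ := h1
  have hlt : σ k j < σ k i := lt_of_le_of_ne hle ((σ k).injective.ne hij.ne')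
  obtain ⟨⟨k', a, ha⟩, hs, hlen, hk, hia, haj⟩ := exists_letter_of_gt hmono hσ hij hlt
  dsimp only at hk hia haj
  subst hk
  obtain ⟨w, hw⟩ := exists_isRedB hmono (mul_mem hσ (letterT_mem hs))
  rw [hPdV σ hσ _ (isRedB_append_of_descent hs hlen hw), ddWordV_append]
  have hfix : permZ0 n (letterT n ⟨k', a, ha⟩) z = z := by
    have hbi : blk ⟨k', i⟩ = blk ⟨k', ⟨a, Nat.lt_of_succ_lt ha⟩⟩ := by
      refine le_antisymm (hmono k' (Fin.le_def.2 hia)) ?_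
      rw [hb]
      exact hmono k' (Fin.le_def.2 (by simp only; omega))
    have hbj : blk ⟨k', ⟨a + 1, ha⟩⟩ = blk ⟨k', j⟩ := by
      rw [← hb, hbi]; exact hs.symm
    have hza : (z : IdxN n → ℤ) ⟨k', ⟨a, Nat.lt_of_succ_lt ha⟩⟩ =
        (z : IdxN n → ℤ) ⟨k', ⟨a + 1, ha⟩⟩ := by
      have e1 := hz k' i ⟨a, Nat.lt_of_succ_lt ha⟩ (Fin.le_def.2 hia) hbi
      have e2 := hz k' ⟨a, Nat.lt_of_succ_lt ha⟩ ⟨a + 1, ha⟩ (Fin.le_def.2 (by simp)) hs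
      have e3 := hz k' ⟨a + 1, ha⟩ j (Fin.le_def.2 haj) hbj
      omega
    ext ⟨m, b⟩
    rw [permZ0_apply]
    by_cases hm : m = k'
    · subst hm
      rw [letterT, simpleT_same, Equiv.swap_inv, Equiv.swap_apply_def]
      split_ifs with h1 h2
      · rw [h1]; exact hza.symm
      · rw [h2]; exact hza
      · rfl
    · rw [letterT, simpleT_of_ne n (mEta n) _ _ hm]
      rfl
  have h0 : ddWordV n [⟨k', a, ha⟩] (T n z) = 0 := by
    rw [ddWordV_cons, ddL_eq]
    change _ • (T n z - sact n _ (T n z)) = 0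
    rw [sact_T, hfix, sub_self, smul_zero]
  rw [h0, ddWordV_zero]

end Family

end ReducedWords

section Symmetrization

instance instFintypeSgEta : Fintype ↥(SgEta n blk) := Fintype.ofFinite _

theorem symK_eq (f : KK n) : symK n blk f =
    (etaFactB n blk : KK n)⁻¹ * ∑ τ : ↥(SgEta n blk), actF n (mEta n) (τ : SgN n) f := rfl

theorem symV_eq (x : VK n) : symV n blk x =
    (etaFactB n blk : KK n)⁻¹ • ∑ τ : ↥(SgEta n blk), sact n (τ : SgN n) x := rfl

theorem etaFactB_ne_zero : (etaFactB n blk : ℂ) ≠ 0 := by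
  have : etaFactB n blk ≠ 0 := Nat.card_pos.ne'
  exact_mod_cast this

theorem etaFactB_cast : (etaFactB n blk : KK n) = algebraMap ℂ (KK n) (etaFactB n blk : ℂ) := by
  simp

theorem etaFactB_cast_ne_zero : (etaFactB n blk : KK n) ≠ 0 := by
  rw [etaFactB_cast]
  exact (map_ne_zero_iff _ (algebraMap ℂ (KK n)).injective).2 (etaFactB_ne_zero n blk)

theorem etaFactB_inv_mem (A : Subalgebra ℂ (KK n)) : (etaFactB n blk : KK n)⁻¹ ∈ A := by
  rw [etaFactB_cast, ← map_inv₀]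
  exact A.algebraMap_mem _

variable {n blk}

theorem symK_add (f g : KK n) : symK n blk (f + g) = symK n blk f + symK n blk g := by
  simp only [symK_eq, map_add, Finset.sum_add_distrib, mul_add]

theorem symK_neg (f : KK n) : symK n blk (-f) = -symK n blk f := by
  simp only [symK_eq, map_neg, Finset.sum_neg_distrib, mul_neg]

theorem symK_actF {σ : SgN n} (hσ : σ ∈ SgEta n blk) (f : KK n) :
    symK n blk (actF n (mEta n) σ f) = symK n blk f := by
  rw [symK_eq, symK_eq]
  congr 1
  simp only [← actF_mul]
  exact Fintype.sum_equiv (Equiv.mulRight (⟨σ, hσ⟩ : ↥(SgEta n blk))) _ _ fun τ => rfl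

theorem actF_symK {σ : SgN n} (hσ : σ ∈ SgEta n blk) (f : KK n) :
    actF n (mEta n) σ (symK n blk f) = symK n blk f := by
  rw [symK_eq, map_mul, map_inv₀, map_natCast, map_sum]
  congr 1
  simp only [← actF_mul]
  exact Fintype.sum_equiv (Equiv.mulLeft (⟨σ, hσ⟩ : ↥(SgEta n blk))) _ _ fun τ => rfl

theorem symV_add (x y : VK n) : symV n blk (x + y) = symV n blk x + symV n blk y := by
  simp only [symV_eq, sact_add, Finset.sum_add_distrib, smul_add]

variable (n blk) in
/-- The symmetrization operator on V_K as an additive map. -/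
def symVHom : VK n →+ VK n := AddMonoidHom.mk' (symV n blk) symV_add

theorem symV_zero : symV n blk 0 = 0 := map_zero (symVHom n blk)

theorem symV_neg (x : VK n) : symV n blk (-x) = -symV n blk x := map_neg (symVHom n blk) x

theorem symV_sub (x y : VK n) : symV n blk (x - y) = symV n blk x - symV n blk y :=
  map_sub (symVHom n blk) x y

theorem symV_sum {ι : Type*} (s : Finset ι) (x : ι → VK n) :
    symV n blk (∑ i ∈ s, x i) = ∑ i ∈ s, symV n blk (x i) := map_sum (symVHom n blk) x s

theorem symV_sact {σ : SgN n} (hσ : σ ∈ SgEta n blk) (x : VK n) :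
    symV n blk (sact n σ x) = symV n blk x := by
  rw [symV_eq, symV_eq]
  congr 1
  simp only [← sact_mul]
  exact Fintype.sum_equiv (Equiv.mulRight (⟨σ, hσ⟩ : ↥(SgEta n blk))) _ _ fun τ => rfl

theorem symV_smul_of_invariant {f : KK n} (hf : ∀ σ ∈ SgEta n blk, actF n (mEta n) σ f = f)
    (x : VK n) : symV n blk (f • x) = f • symV n blk x := by
  have h : ∑ τ : ↥(SgEta n blk), sact n (τ : SgN n) (f • x) =
      f • ∑ τ : ↥(SgEta n blk), sact n (τ : SgN n) x := by
    rw [Finset.smul_sum]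
    exact Finset.sum_congr rfl fun τ _ => by rw [sact_smul, hf τ τ.2]
  rw [symV_eq, symV_eq, h, smul_comm]

theorem symV_smul_sact {σ : SgN n} (hσ : σ ∈ SgEta n blk) (f : KK n) (x : VK n) :
    symV n blk (f • sact n σ x) = symV n blk (actF n (mEta n) σ⁻¹ f • x) := by
  rw [← symV_sact hσ (actF n (mEta n) σ⁻¹ f • x), sact_smul, ← actF_mul, mul_inv_cancel, actF_one]

theorem letterT_inv (s : SimpleDat n (mEta n)) : (letterT n s)⁻¹ = letterT n s :=
  inv_eq_of_mul_eq_one_right (letterT_mul_self s)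

variable (n) in
/-- The operator adjoint to a divided difference with respect to symmetrization. -/
def ddAdj (s : SimpleDat n (mEta n)) (c : KK n) : KK n :=
  (alphaL n s)⁻¹ * (c + actF n (mEta n) (letterT n s) c)

theorem actF_alphaL_inv (s : SimpleDat n (mEta n)) :
    actF n (mEta n) (letterT n s) (alphaL n s)⁻¹ = -(alphaL n s)⁻¹ := by
  rw [map_inv₀, actF_alphaL]
  exact inv_neg

theorem actF_letterT_letterT (s : SimpleDat n (mEta n)) (c : KK n) :
    actF n (mEta n) (letterT n s) (actF n (mEta n) (letterT n s) c) = c := by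
  rw [← actF_mul, letterT_mul_self, actF_one]

theorem symV_smul_ddL {s : SimpleDat n (mEta n)} (hs : LetterBlk n blk s) (c : KK n) (x : VK n) :
    symV n blk (c • ddL n s x) = symV n blk (ddAdj n s c • x) := by
  have h : c • ddL n s x =
      (c * (alphaL n s)⁻¹) • x + (-(c * (alphaL n s)⁻¹)) • sact n (letterT n s) x := by
    rw [ddL_eq, smul_smul, smul_sub, neg_smul, sub_eq_add_neg]
  rw [h, symV_add, symV_smul_sact (letterT_mem hs), ← symV_add, ← add_smul, letterT_inv,
    map_neg, map_mul, actF_alphaL_inv]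
  congr 2
  rw [ddAdj]
  ring

theorem symK_mul_ddAdj {s : SimpleDat n (mEta n)} (hs : LetterBlk n blk s) (a c : KK n) :
    symK n blk (a * ddAdj n s c) =
      symK n blk (((alphaL n s)⁻¹ * (a - actF n (mEta n) (letterT n s) a)) * c) := by
  have h : a * ddAdj n s c = a * (alphaL n s)⁻¹ * c +
      actF n (mEta n) (letterT n s)
        (-(actF n (mEta n) (letterT n s) a * (alphaL n s)⁻¹ * c)) := by
    rw [map_neg, map_mul, map_mul, actF_letterT_letterT, actF_alphaL_inv, ddAdj]
    ring
  rw [h, symK_add, symK_actF (letterT_mem hs), ← symK_add]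
  congr 1
  ring

/-- A subalgebra of K stable under the symmetric group and all divided differences. -/
structure DDStable (A : Subalgebra ℂ (KK n)) : Prop where
  act : ∀ (σ : SgN n), ∀ a ∈ A, actF n (mEta n) σ a ∈ A
  alpha : ∀ s, alphaL n s ∈ A
  dd : ∀ s, ∀ a ∈ A, (alphaL n s)⁻¹ * (a - actF n (mEta n) (letterT n s) a) ∈ A

variable (blk) in
/-- The lattice dual to a subalgebra of K with respect to symmetrization of products. -/
def dualLat (A : Subalgebra ℂ (KK n)) : Set (KK n) := {m | ∀ a ∈ A, symK n blk (a * m) ∈ A}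

variable {A : Subalgebra ℂ (KK n)} {m m' : KK n}

theorem symK_mem (hA : DDStable A) (hm : m ∈ A) : symK n blk m ∈ A := by
  rw [symK_eq]
  exact mul_mem (etaFactB_inv_mem n blk A) (sum_mem fun τ _ => hA.act _ _ hm)

theorem symK_mem_of_dualLat (hm : m ∈ dualLat blk A) : symK n blk m ∈ A := by
  simpa using hm 1 (one_mem _)

theorem one_mem_dualLat (hA : DDStable A) : (1 : KK n) ∈ dualLat blk A := fun a ha => by
  rw [mul_one]
  exact symK_mem hA ha

theorem sub_mem_dualLat (hm : m ∈ dualLat blk A) (hm' : m' ∈ dualLat blk A) :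
    m - m' ∈ dualLat blk A := fun a ha => by
  rw [mul_sub, sub_eq_add_neg, symK_add, symK_neg, ← sub_eq_add_neg]
  exact sub_mem (hm a ha) (hm' a ha)

theorem mul_mem_dualLat {b : KK n} (hb : b ∈ A) (hm : m ∈ dualLat blk A) :
    b * m ∈ dualLat blk A := fun a ha => by
  rw [← mul_assoc]
  exact hm _ (mul_mem ha hb)

theorem actF_mem_dualLat (hA : DDStable A) (hm : m ∈ dualLat blk A) {σ : SgN n}
    (hσ : σ ∈ SgEta n blk) : actF n (mEta n) σ m ∈ dualLat blk A := fun a ha => by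
  have h : a * actF n (mEta n) σ m = actF n (mEta n) σ (actF n (mEta n) σ⁻¹ a * m) := by
    rw [map_mul, ← actF_mul, mul_inv_cancel, actF_one]
  rw [h, symK_actF hσ]
  exact hm _ (hA.act _ _ ha)

theorem ddAdj_mem_dualLat (hA : DDStable A) (hm : m ∈ dualLat blk A) {s : SimpleDat n (mEta n)}
    (hs : LetterBlk n blk s) : ddAdj n s m ∈ dualLat blk A := fun a ha => by
  rw [symK_mul_ddAdj hs]
  exact hm _ (hA.dd s a ha)

theorem exists_symV_smul_ddWordV (hA : DDStable A) {w : Word n (mEta n)} (hw : WordBlk n blk w)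
    (hm : m ∈ dualLat blk A) : ∃ m' ∈ dualLat blk A, ∀ x : VK n,
      symV n blk (m • ddWordV n w x) = symV n blk (m' • x) := by
  induction w generalizing m with
  | nil => exact ⟨m, hm, fun _ => rfl⟩
  | cons s w ih =>
    have hs : LetterBlk n blk s := hw s List.mem_cons_self
    obtain ⟨m', hm', h⟩ := ih (fun t ht => hw t (List.mem_cons_of_mem s ht))
      (ddAdj_mem_dualLat hA hm hs)
    exact ⟨m', hm', fun x => by rw [ddWordV_cons, symV_smul_ddL hs, h]⟩

theorem exists_ddAdj_eq (hA : DDStable A) (hm : m ∈ dualLat blk A) {s : SimpleDat n (mEta n)}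
    (hs : LetterBlk n blk s) :
    ∃ c ∈ dualLat blk A, ddAdj n s c = m - actF n (mEta n) (letterT n s) m := by
  have h2 : (2 : KK n) ≠ 0 := by
    have h : algebraMap ℂ (KK n) 2 ≠ 0 :=
      (map_ne_zero_iff _ (algebraMap ℂ (KK n)).injective).2 two_ne_zero
    rwa [map_ofNat] at h
  refine ⟨algebraMap ℂ (KK n) 2⁻¹ * (alphaL n s * (m - actF n (mEta n) (letterT n s) m)),
    mul_mem_dualLat (A.algebraMap_mem _) (mul_mem_dualLat (hA.alpha s)
      (sub_mem_dualLat hm (actF_mem_dualLat hA hm (letterT_mem hs)))), ?_⟩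
  have hα := alphaL_ne_zero s
  rw [ddAdj, map_inv₀, map_ofNat, map_mul, map_mul, map_sub, actF_letterT_letterT, actF_alphaL,
    map_inv₀, map_ofNat]
  field_simp
  ring

section Family

variable (hmono : ∀ k : Fin n, Monotone fun i : Fin ((k : ℕ) + 1) => blk ⟨k, i⟩)
variable {PdV : SgN n → VK n → VK n}
variable (hPdV : ∀ σ ∈ SgEta n blk, ∀ w : Word n (mEta n), IsRedB n blk σ w →
      ∀ x : VK n, PdV σ x = ddWordV n w x)
include hmono hPdV

theorem symV_smul_ddWordV_mem (hA : DDStable A) {W : AddSubgroup (VK n)}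
    (hW : ∀ a ∈ A, ∀ w ∈ W, a • w ∈ W) {v : VK n}
    (hD : ∀ σ ∈ SgEta n blk, symV n blk (PdV σ v) ∈ W) {l : ℕ}
    (hl : ∀ w : Word n (mEta n), WordBlk n blk w → l < w.length → ∀ x, ddWordV n w x = 0)
    (d : ℕ) {w : Word n (mEta n)} (hw : WordBlk n blk w) (hd : l < w.length + d)
    (hm : m ∈ dualLat blk A) : symV n blk (m • ddWordV n w v) ∈ W := by
  induction d generalizing w m with
  | zero =>
    rw [hl w hw hd, smul_zero, symV_zero]
    exact zero_mem W
  | succ d ih =>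
    have hletter : ∀ s, LetterBlk n blk s → ∀ b ∈ dualLat blk A,
        symV n blk ((b - actF n (mEta n) (letterT n s) b) • ddWordV n w v) ∈ W := by
      intro s hs b hb
      obtain ⟨c, hc, hcb⟩ := exists_ddAdj_eq hA hb hs
      rw [← hcb, ← symV_smul_ddL hs, ← ddWordV_cons]
      refine ih (fun t ht => ?_) (by rw [List.length_cons]; omega) hc
      rcases List.mem_cons.1 ht with rfl | ht
      · exact hs
      · exact hw t ht
    have hword : ∀ u : Word n (mEta n), WordBlk n blk u →
        symV n blk ((m - actF n (mEta n) (wordPerm n (mEta n) u) m) • ddWordV n w v) ∈ W := by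
      intro u
      induction u with
      | nil =>
        intro _
        have h1 : wordPerm n (mEta n) [] = 1 := rfl
        rw [h1, actF_one, sub_self, zero_smul, symV_zero]
        exact zero_mem W
      | cons s u ihu =>
        intro hu
        have hu' : WordBlk n blk u := fun t ht => hu t (List.mem_cons_of_mem s ht)
        have h1 := ihu hu'
        have h2 := hletter s (hu s List.mem_cons_self) _
          (actF_mem_dualLat hA hm (wordPerm_mem hu'))
        rw [wordPerm_cons, actF_mul]
        have h3 := add_mem h1 h2
        rwa [← symV_add, ← add_smul, sub_add_sub_cancel] at h3
    have hperm : ∀ τ ∈ SgEta n blk,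
        symV n blk ((m - actF n (mEta n) τ m) • ddWordV n w v) ∈ W := by
      intro τ hτ
      obtain ⟨u, hu⟩ := exists_isRedB hmono hτ
      rw [← hu.1.1]
      exact hword u hu.2
    have hbase : symV n blk (ddWordV n w v) ∈ W := by
      rcases isRedB_or_ddWordV_eq_zero hmono hPdV hw with h | h
      · rw [← hPdV _ (wordPerm_mem hw) w h]
        exact hD _ (wordPerm_mem hw)
      · rw [h, symV_zero]
        exact zero_mem W
    have hN := etaFactB_cast_ne_zero n blk
    have hcard : ((Finset.univ : Finset ↥(SgEta n blk)).card : KK n) = etaFactB n blk := by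
      rw [Finset.card_univ, etaFactB, Nat.card_eq_fintype_card]
    have hsplit : m = symK n blk m + (etaFactB n blk : KK n)⁻¹ *
        ∑ τ : ↥(SgEta n blk), (m - actF n (mEta n) (τ : SgN n) m) := by
      rw [symK_eq, Finset.sum_sub_distrib, Finset.sum_const, nsmul_eq_mul, hcard, mul_sub,
        inv_mul_cancel_left₀ hN, add_sub_cancel]
    rw [hsplit, add_smul, symV_add, symV_smul_of_invariant fun σ hσ => actF_symK hσ m, mul_smul,
      symV_smul_of_invariant fun σ _ => by rw [map_inv₀, map_natCast]]
    refine add_mem (hW _ (symK_mem_of_dualLat hm) _ hbase) (hW _ (etaFactB_inv_mem n blk A) _ ?_)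
    rw [Finset.sum_smul, symV_sum]
    exact sum_mem fun τ _ => hperm τ τ.2

theorem symV_smul_mem (hA : DDStable A) {W : AddSubgroup (VK n)}
    (hW : ∀ a ∈ A, ∀ w ∈ W, a • w ∈ W) {v : VK n}
    (hD : ∀ σ ∈ SgEta n blk, symV n blk (PdV σ v) ∈ W) (hm : m ∈ dualLat blk A) :
    symV n blk (m • v) ∈ W := by
  obtain ⟨l, hl⟩ := exists_ddWordV_bound hmono hPdV
  exact symV_smul_ddWordV_mem hmono hPdV hA hW hD hl (l + 1) (w := [])
    (fun s hs => by simp at hs) (by simp) hm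

end Family

end Symmetrization

section Stable

theorem X_sub_dvd_sub_actP (s : SimpleDat n (mEta n)) (p : PolN n) :
    (MvPolynomial.X ⟨s.1, ⟨s.2.1, Nat.lt_of_succ_lt s.2.2⟩⟩ -
      MvPolynomial.X ⟨s.1, ⟨s.2.1 + 1, s.2.2⟩⟩ : PolN n) ∣
      p - actP n (mEta n) (letterT n s) p := by
  induction p using MvPolynomial.induction_on with
  | C a => rw [actP_C, sub_self]; exact dvd_zero _
  | add p q hp hq =>
    rw [map_add, add_sub_add_comm]
    exact dvd_add hp hq
  | mul_X p i hp =>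
    rw [map_mul, actP_X]
    have h : p * MvPolynomial.X i - actP n (mEta n) (letterT n s) p *
        MvPolynomial.X (permIdx n (mEta n) (letterT n s) i) =
        (p - actP n (mEta n) (letterT n s) p) * MvPolynomial.X i +
          actP n (mEta n) (letterT n s) p * (MvPolynomial.X i -
            MvPolynomial.X (permIdx n (mEta n) (letterT n s) i)) := by
      ring
    rw [h]
    refine dvd_add (dvd_mul_of_dvd_left hp _) (dvd_mul_of_dvd_right ?_ _)
    obtain ⟨k, i⟩ := i
    change _ ∣ (MvPolynomial.X ⟨k, i⟩ - MvPolynomial.X ⟨k, letterT n s k i⟩ : PolN n)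
    by_cases hk : k = s.1
    · subst hk
      rw [letterT, simpleT_same, Equiv.swap_apply_def]
      split_ifs with h1 h2
      · rw [h1]
      · rw [h2]; exact dvd_sub_comm.1 dvd_rfl
      · rw [sub_self]; exact dvd_zero _
    · rw [letterT, simpleT_of_ne n (mEta n) _ _ hk, Equiv.Perm.one_apply, sub_self]
      exact dvd_zero _

/-- The polynomial ring as a subalgebra of K. -/
def polyAlg : Subalgebra ℂ (KK n) := (IsScalarTower.toAlgHom ℂ (PolN n) (KK n)).range

theorem algebraMap_mem_polyAlg (p : PolN n) : algebraMap (PolN n) (KK n) p ∈ polyAlg n := ⟨p, rfl⟩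

theorem polyAlg_le_Balg : polyAlg n ≤ Balg n blk := by
  rintro _ ⟨p, rfl⟩
  exact ⟨p, 1, one_mem _, by rw [map_one, mul_one]; rfl⟩

variable {n}

theorem ddStable_polyAlg : DDStable (polyAlg n) where
  act := by
    rintro σ _ ⟨p, rfl⟩
    change actF n (mEta n) σ (algebraMap (PolN n) (KK n) p) ∈ _
    rw [actF_algebraMap]
    exact algebraMap_mem_polyAlg n _
  alpha s := sub_mem (algebraMap_mem_polyAlg n _) (algebraMap_mem_polyAlg n _)
  dd := by
    rintro s _ ⟨p, rfl⟩
    change (alphaL n s)⁻¹ * (algebraMap (PolN n) (KK n) p -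
      actF n (mEta n) (letterT n s) (algebraMap (PolN n) (KK n) p)) ∈ _
    obtain ⟨q, hq⟩ := X_sub_dvd_sub_actP n s p
    have h : alphaL n s = algebraMap (PolN n) (KK n)
        (MvPolynomial.X ⟨s.1, ⟨s.2.1, Nat.lt_of_succ_lt s.2.2⟩⟩ -
          MvPolynomial.X ⟨s.1, ⟨s.2.1 + 1, s.2.2⟩⟩) := by
      rw [map_sub]; rfl
    rw [actF_algebraMap, ← map_sub, hq, map_mul, ← h, inv_mul_cancel_left₀ (alphaL_ne_zero s)]
    exact algebraMap_mem_polyAlg n _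

theorem ddStable_top : DDStable (⊤ : Subalgebra ℂ (KK n)) :=
  ⟨fun _ _ _ => Algebra.mem_top, fun _ => Algebra.mem_top, fun _ _ _ => Algebra.mem_top⟩

end Stable

section Orbits

/-- The key by which the entries of a row are sorted in normal form. -/
def sortKey (z : Z0 n) (k : Fin n) (i : Fin ((k : ℕ) + 1)) : ℕ ×ₗ ℤ :=
  toLex (blk ⟨k, i⟩, -(z : IdxN n → ℤ) ⟨k, i⟩)

variable {n blk}

theorem sortKey_eq_iff {z z' : Z0 n} {k : Fin n} {i j : Fin ((k : ℕ) + 1)} :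
    sortKey n blk z k i = sortKey n blk z' k j ↔ blk ⟨k, i⟩ = blk ⟨k, j⟩ ∧
      (z : IdxN n → ℤ) ⟨k, i⟩ = (z' : IdxN n → ℤ) ⟨k, j⟩ := by
  simp [sortKey]

theorem monotone_blk_of_monotone_sortKey {z : Z0 n} {k : Fin n}
    {τ : Equiv.Perm (Fin ((k : ℕ) + 1))} (h : Monotone (sortKey n blk z k ∘ τ)) :
    Monotone ((fun i => blk ⟨k, i⟩) ∘ τ) :=
  (Prod.Lex.monotone_fst_ofLex (α := ℕ) (β := ℤ)).comp h

section Monotone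

variable (hmono : ∀ k : Fin n, Monotone fun i : Fin ((k : ℕ) + 1) => blk ⟨k, i⟩)
include hmono

theorem monotone_sortKey {z : Z0 n} (hz : z ∈ Nset n blk) (k : Fin n) :
    Monotone (sortKey n blk z k) := by
  intro i j hij
  rw [sortKey, sortKey, Prod.Lex.toLex_le_toLex]
  rcases (hmono k hij).lt_or_eq with h | h
  · exact Or.inl h
  · exact Or.inr ⟨h, neg_le_neg (hz k i j hij h)⟩

theorem exists_permZ0_eq (z : Z0 n) : ∃ z' ∈ Nset n blk, ∃ σ ∈ SgEta n blk, z = permZ0 n σ z' := by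
  let τ : SgN n := fun k => Tuple.sort (sortKey n blk z k)
  have hτm : ∀ k, Monotone (sortKey n blk z k ∘ τ k) := fun k => Tuple.monotone_sort _
  have hτb : ∀ (k : Fin n) i, blk ⟨k, τ k i⟩ = blk ⟨k, i⟩ := fun k =>
    congrFun (Tuple.unique_monotone (f := fun i => blk ⟨k, i⟩) (τ := Equiv.refl _)
      (monotone_blk_of_monotone_sortKey (hτm k)) (hmono k))
  have hτ : τ ∈ SgEta n blk := (mem_SgEta n blk).2 hτb
  refine ⟨permZ0 n τ⁻¹ z, ?_, τ, hτ, ?_⟩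
  · intro k i j hij hb
    rw [permZ0_apply, permZ0_apply, Pi.inv_apply, inv_inv]
    have h := hτm k hij
    simp only [Function.comp_apply, sortKey, Prod.Lex.toLex_le_toLex, hτb] at h
    rcases h with h | h
    · exact absurd hb h.ne
    · exact neg_le_neg_iff.1 h.2
  · rw [← permZ0_mul, mul_inv_cancel]
    ext ⟨k, i⟩
    rfl

theorem permZ0_shuffle_injective :
    Function.Injective fun x : BIdx n blk => permZ0 n x.1.2 x.1.1 := by
  rintro ⟨⟨z, σ⟩, hz, hσ, hsh⟩ ⟨⟨z', σ'⟩, hz', hσ', hsh'⟩ h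
  dsimp only at h hz hσ hsh hz' hσ' hsh'
  set τ : SgN n := σ'⁻¹ * σ with hτdef
  have hτ : τ ∈ SgEta n blk := mul_mem (inv_mem hσ') hσ
  have hzτ : z = permZ0 n τ⁻¹ z' := by
    have h1 : permZ0 n σ⁻¹ (permZ0 n σ z) = permZ0 n σ⁻¹ (permZ0 n σ' z') := congrArg _ h
    rw [← permZ0_mul, ← permZ0_mul, inv_mul_cancel] at h1
    rw [hτdef, mul_inv_rev, inv_inv, ← h1]
    ext ⟨k, i⟩
    rfl
  have hkey : ∀ k, sortKey n blk z' k ∘ τ k = sortKey n blk z k := by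
    intro k
    funext i
    refine sortKey_eq_iff.2 ⟨(mem_SgEta n blk).1 hτ k i, ?_⟩
    rw [hzτ, permZ0_apply, Pi.inv_apply, inv_inv]
  have hzz : z = z' := by
    ext ⟨k, i⟩
    have h1 : sortKey n blk z' k ∘ τ k = sortKey n blk z' k ∘ Equiv.refl _ :=
      Tuple.unique_monotone (by rw [hkey k]; exact monotone_sortKey hmono hz k)
        (monotone_sortKey hmono hz' k)
    rw [hkey k] at h1
    exact (sortKey_eq_iff.1 (congrFun h1 i)).2
  subst hzz
  have hτ1 : τ = 1 := by
    funext k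
    refine perm_eq_one_of_strictMono fun i j hij => ?_
    rcases (monotone_sortKey hmono hz k hij.le).lt_or_eq with hlt | heq
    · rw [← hkey k] at hlt
      exact (monotone_sortKey hmono hz k).reflect_lt hlt
    · by_contra hcon
      have hne : τ k j < τ k i := lt_of_le_of_ne (not_lt.1 hcon) ((τ k).injective.ne hij.ne')
      have hk' : sortKey n blk z k (τ k j) = sortKey n blk z k (τ k i) :=
        (congrFun (hkey k) j).trans (heq.symm.trans (congrFun (hkey k) i).symm)
      obtain ⟨hb1, hz1⟩ := sortKey_eq_iff.1 hk'
      obtain ⟨hb2, hz2⟩ := sortKey_eq_iff.1 heq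
      have h1 := hsh' k _ _ hne hb1 hz1
      have h2 := hsh k i j hij hb2 hz2
      simp [hτdef] at h1
      exact absurd h1 h2.not_gt
  have : σ = σ' := (inv_mul_eq_one.1 hτ1).symm
  subst this
  rfl

end Monotone

end Orbits

section DerivedTableaux

variable {n blk}

theorem linearIndependent_T : LinearIndependent (KK n) (T n) :=
  Finsupp.linearIndependent_single_one (KK n) (Z0 n)

variable (hmono : ∀ k : Fin n, Monotone fun i : Fin ((k : ℕ) + 1) => blk ⟨k, i⟩)
variable {PdV : SgN n → VK n → VK n}
variable (hPdV : ∀ σ ∈ SgEta n blk, ∀ w : Word n (mEta n), IsRedB n blk σ w →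
      ∀ x : VK n, PdV σ x = ddWordV n w x)
include hmono hPdV

theorem symV_PdV_T_mem {z : Z0 n} (hz : z ∈ Nset n blk) {W : AddSubgroup (VK n)}
    (hD : ∀ σ, IsShuffle n blk z σ → symV n blk (PdV σ (T n z)) ∈ W) :
    ∀ σ ∈ SgEta n blk, symV n blk (PdV σ (T n z)) ∈ W := by
  intro σ hσ
  by_cases h : IsShuffle n blk z σ
  · exact hD σ h
  · rw [PdV_T_eq_zero hmono hPdV hz hσ h, symV_zero]
    exact zero_mem W

theorem T_permZ0_mem {z : Z0 n} (hz : z ∈ Nset n blk) {W : Submodule (KK n) (VK n)}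
    (hD : ∀ σ, IsShuffle n blk z σ → symV n blk (PdV σ (T n z)) ∈ W) {ρ : SgN n}
    (hρ : ρ ∈ SgEta n blk) : T n (permZ0 n ρ z) ∈ W := by
  have hW : ∀ m : KK n, symV n blk (m • T n z) ∈ W := fun m =>
    symV_smul_mem hmono hPdV ddStable_top (W := W.toAddSubgroup) (fun a _ w hw => W.smul_mem a hw)
      (symV_PdV_T_mem hmono hPdV hz hD) (fun _ _ => Algebra.mem_top)
  by_contra hcon
  obtain ⟨φ, hφ, hle⟩ := Submodule.exists_le_ker_of_notMem hcon
  let χ : ↥(SgEta n blk) → (KK n →* KK n) := fun τ => (actF n (mEta n) (τ : SgN n)).toMonoidHom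
  have hχ : Function.Injective χ := fun τ τ' h =>
    Subtype.ext (actF_injective n (mEta n) (funext fun f => DFunLike.congr_fun h f))
  have hli := (linearIndependent_monoidHom (KK n) (KK n)).comp χ hχ
  refine hφ (Fintype.linearIndependent_iff.1 hli (fun τ => φ (T n (permZ0 n (τ : SgN n) z))) ?_
    ⟨ρ, hρ⟩)
  funext m
  have h := hle (hW m)
  rw [LinearMap.mem_ker, symV_eq, map_smul, map_sum, smul_eq_zero] at h
  have h0 := h.resolve_left (inv_ne_zero (etaFactB_cast_ne_zero n blk))
  rw [Finset.sum_apply, Pi.zero_apply, ← h0]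
  refine Finset.sum_congr rfl fun τ _ => ?_
  rw [sact_smul, sact_T, map_smul, smul_eq_mul, mul_comm]
  rfl

theorem linearIndependent_derivedTableaux : LinearIndependent (KK n)
    (fun x : BIdx n blk => symV n blk (PdV x.1.2 (T n x.1.1))) := by
  classical
  rw [linearIndependent_iff_finset_linearIndependent]
  intro s
  let Z : Finset (Z0 n) := s.image fun x => x.1.1
  let ι := {x : BIdx n blk // x.1.1 ∈ Z}
  have hfin : Finite ι := by
    refine Finite.of_injective (fun x : ι => ((⟨x.1.1.1, x.2⟩ : Z), x.1.1.2)) fun x y h => ?_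
    simp only [Prod.mk.injEq, Subtype.mk.injEq] at h
    exact Subtype.ext (Subtype.ext (Prod.ext h.1 h.2))
  have hft : Fintype ι := Fintype.ofFinite ι
  let D : ι → VK n := fun x => symV n blk (PdV x.1.1.2 (T n x.1.1.1))
  let t : ι → VK n := fun x => T n (permZ0 n x.1.1.2 x.1.1.1)
  have ht : LinearIndependent (KK n) t :=
    linearIndependent_T.comp (fun x : ι => permZ0 n x.1.1.2 x.1.1.1)
      ((permZ0_shuffle_injective hmono).comp Subtype.val_injective)
  have hspan : Submodule.span (KK n) (Set.range t) ≤ Submodule.span (KK n) (Set.range D) := by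
    rw [Submodule.span_le]
    rintro _ ⟨⟨⟨⟨z, σ⟩, hz, hσ⟩, hx⟩, rfl⟩
    exact T_permZ0_mem hmono hPdV hz
      (fun σ' hσ' => Submodule.subset_span
        (Set.mem_range_self (⟨⟨⟨z, σ'⟩, hz, hσ'⟩, hx⟩ : ι))) hσ.1
  have hfd : FiniteDimensional (KK n) (Submodule.span (KK n) (Set.range D)) :=
    FiniteDimensional.span_of_finite _ (Set.finite_range D)
  have hD : LinearIndependent (KK n) D := by
    rw [linearIndependent_iff_card_le_finrank_span, ← finrank_span_eq_card ht]
    exact Submodule.finrank_mono hspan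
  exact hD.comp (fun x : s => ⟨x.1, Finset.mem_image_of_mem _ x.2⟩)
    fun x y h => Subtype.ext (congrArg (fun u : ι => u.1) h)

theorem span_derivedTableaux :
    Submodule.span ↥(Balg n blk)
        (Set.range fun x : BIdx n blk => symV n blk (PdV x.1.2 (T n x.1.1))) =
      Submodule.span ↥(Balg n blk)
        {w : VK n | ∃ σ ∈ SgEta n blk, ∃ z : Z0 n, w = symV n blk (PdV σ (T n z))} := by
  refine le_antisymm (Submodule.span_mono ?_) (Submodule.span_le.2 ?_)
  · rintro _ ⟨⟨⟨z, σ⟩, hz, hσ⟩, rfl⟩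
    exact ⟨σ, hσ.1, z, rfl⟩
  · rintro _ ⟨σ, hσ, z, rfl⟩
    obtain ⟨z', hz', ρ, hρ, rfl⟩ := exists_permZ0_eq hmono z
    obtain ⟨w, hw⟩ := exists_isRedB hmono hσ
    obtain ⟨m, hm, h⟩ :=
      exists_symV_smul_ddWordV ddStable_polyAlg hw.2 (one_mem_dualLat ddStable_polyAlg)
    rw [hPdV σ hσ w hw, ← one_smul (KK n) (ddWordV n w _), h, ← sact_T, symV_smul_sact hρ]
    refine symV_smul_mem hmono hPdV ddStable_polyAlg (W := (Submodule.span _ _).toAddSubgroup)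
      (fun a ha v hv => Submodule.smul_mem _ (⟨a, polyAlg_le_Balg n blk ha⟩ : Balg n blk) hv)
      (symV_PdV_T_mem hmono hPdV hz' fun σ' hσ' =>
        Submodule.subset_span ⟨⟨⟨z', σ'⟩, hz', hσ'⟩, rfl⟩)
      (actF_mem_dualLat ddStable_polyAlg hm (inv_mem hρ))

end DerivedTableaux

/-- the derived tableaux {D_σ^η T(z) : z ∈ N_η, σ ∈ Shuffle^η_{ε(z)}} form
a basis of the B_η-lattice L_η; in particular L_η is a free B_η-module.  Here `PdV` is
the family of divided difference operators ∂_σ on V_K, characterized by its values along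
reduced decompositions, L_η is the B_η-submodule of V_K generated by all D_σ^η T(z) with
σ ∈ S_η, z ∈ ℤ^μ_0, and D_σ^η = sym_η ∘ ∂_σ. -/
theorem statement15 (n : ℕ) (blk : IdxN n → ℕ)
    (hmono : ∀ k : Fin n, Monotone fun i : Fin ((k : ℕ) + 1) => blk ⟨k, i⟩)
    (htop : ∀ (k : Fin n) (i j : Fin ((k : ℕ) + 1)), (k : ℕ) + 1 = n →
      blk ⟨k, i⟩ = blk ⟨k, j⟩ → i = j)
    (PdV : SgN n → VK n → VK n)
    (hPdV : ∀ σ ∈ SgEta n blk, ∀ w : Word n (mEta n), IsRedB n blk σ w →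
      ∀ x : VK n, PdV σ x = ddWordV n w x) :
    LinearIndependent ↥(Balg n blk)
      (fun x : BIdx n blk => symV n blk (PdV x.1.2 (T n x.1.1))) ∧
    Submodule.span ↥(Balg n blk)
        (Set.range fun x : BIdx n blk => symV n blk (PdV x.1.2 (T n x.1.1))) =
      Submodule.span ↥(Balg n blk)
        {w : VK n | ∃ σ ∈ SgEta n blk, ∃ z : Z0 n, w = symV n blk (PdV σ (T n z))} := by
  exact ⟨(linearIndependent_derivedTableaux hmono hPdV).restrict_scalars' _,
    span_derivedTableaux hmono hPdV⟩

end GTpaper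

end
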